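/- arXiv:1208.5224 — 2 statements merged into one kernel-verified Lean document; each statement's English description precedes it below -/
import Mathlib

section
/- Let μ be a finite Borel measure on ℝ with Borel transform F. Then the set M_sc = {x ∈ ℝ : Im F(x+iy) → +∞ as y ↘ 0 and y·F(x+iy) → 0 as y ↘ 0} is a support for the singular continuous part μ_sc of μ, that is, μ_sc(ℝ \ M_sc) = 0. -/
open MeasureTheory Filter Complex Set

/-- The Borel transform of a measure on `ℝ`. -/
noncomputable def borelTransform (μ : Measure ℝ) (z : ℂ) : ℂ :=
  ∫ t : ℝ, (1 : ℂ) / ((t : ℂ) - z) ∂μ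

/-- The singular continuous part of a finite Borel measure on `ℝ`: the restriction of the
singular part (w.r.t. Lebesgue measure) to the set of points with no point mass. -/
noncomputable def scPart (μ : Measure ℝ) : Measure ℝ :=
  (μ.singularPart volume).restrict {x : ℝ | μ {x} = 0}

theorem norm_one_div_ofReal_sub_le (x t : ℝ) {y : ℝ} (hy : 0 < y) :
    ‖(1 : ℂ) / ((t : ℂ) - ((x : ℂ) + y * Complex.I))‖ ≤ 1 / y := by
  rw [norm_div, norm_one]
  refine one_div_le_one_div_of_le hy ?_
  refine le_trans ?_ (Complex.abs_im_le_norm _)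
  simp [abs_of_pos hy]

theorem measurable_one_div_ofReal_sub (z : ℂ) :
    Measurable fun t : ℝ => (1 : ℂ) / ((t : ℂ) - z) := by
  fun_prop

theorem integrable_one_div_ofReal_sub (μ : Measure ℝ) [IsFiniteMeasure μ] (x : ℝ) {y : ℝ}
    (hy : 0 < y) :
    Integrable (fun t : ℝ => (1 : ℂ) / ((t : ℂ) - ((x : ℂ) + y * Complex.I))) μ :=
  Integrable.of_bound (measurable_one_div_ofReal_sub _).aestronglyMeasurable (1 / y)
    (ae_of_all _ fun t => norm_one_div_ofReal_sub_le x t hy)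

/-- The imaginary part of the Borel transform is a Poisson integral. -/
theorem borelTransform_im (μ : Measure ℝ) [IsFiniteMeasure μ] (x : ℝ) {y : ℝ} (hy : 0 < y) :
    (borelTransform μ ((x : ℂ) + y * Complex.I)).im = ∫ t : ℝ, y / ((t - x) ^ 2 + y ^ 2) ∂μ := by
  have h := integral_im (𝕜 := ℂ) (integrable_one_div_ofReal_sub μ x hy)
  refine Eq.trans h.symm (integral_congr_ae (ae_of_all _ fun t => ?_))
  simp [Complex.normSq_apply, pow_two]

/-- The Poisson integral dominates the symmetric difference quotient of the measure. -/
theorem measureReal_closedBall_div_le_borelTransform_im (μ : Measure ℝ) [IsFiniteMeasure μ]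
    (x : ℝ) {y : ℝ} (hy : 0 < y) :
    μ.real (Metric.closedBall x y) / (2 * y) ≤
      (borelTransform μ ((x : ℂ) + y * Complex.I)).im := by
  rw [borelTransform_im μ x hy]
  have hint : Integrable (fun t : ℝ => y / ((t - x) ^ 2 + y ^ 2)) μ := by
    refine (integrable_one_div_ofReal_sub μ x hy).im.congr (ae_of_all _ fun t => ?_)
    simp [Complex.normSq_apply, pow_two]
  have hconst : ∫ t : ℝ, (Metric.closedBall x y).indicator (fun _ => 1 / (2 * y)) t ∂μ =
      μ.real (Metric.closedBall x y) / (2 * y) := by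
    rw [integral_indicator_const _ Metric.isClosed_closedBall.measurableSet, smul_eq_mul,
      mul_one_div]
  rw [← hconst]
  refine integral_mono ((integrable_const _).indicator
    Metric.isClosed_closedBall.measurableSet) hint fun t => ?_
  refine indicator_apply_le' (fun ht => ?_) fun _ => by positivity
  rw [Metric.mem_closedBall, Real.dist_eq] at ht
  have hsq : (t - x) ^ 2 ≤ y ^ 2 := sq_le_sq.2 (by rwa [abs_of_pos hy])
  rw [div_le_div_iff₀ (by positivity) (by positivity)]
  nlinarith

/-- At almost every point of the singular part, the imaginary part of the Borel transform blows
up. -/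
theorem ae_singularPart_tendsto_borelTransform_im_atTop (μ : Measure ℝ) [IsFiniteMeasure μ] :
    ∀ᵐ x : ℝ ∂μ.singularPart volume,
      Tendsto (fun y : ℝ => (borelTransform μ ((x : ℂ) + y * Complex.I)).im)
        (nhdsWithin 0 (Set.Ioi 0)) atTop := by
  have hsing : (volume : Measure ℝ).rnDeriv (μ.singularPart volume)
      =ᵐ[μ.singularPart volume] 0 :=
    (Measure.mutuallySingular_singularPart μ volume).symm.rnDeriv_ae_eq_zero
  filter_upwards [Besicovitch.ae_tendsto_rnDeriv volume (μ.singularPart volume), hsing]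
    with x hx hx0
  rw [hx0, Pi.zero_apply, ← tendsto_inv_iff, ENNReal.inv_zero] at hx
  have htop : Tendsto (fun y : ℝ => ENNReal.ofReal (μ.real (Metric.closedBall x y) / (2 * y)))
      (nhdsWithin 0 (Set.Ioi 0)) (nhds ⊤) := by
    refine tendsto_nhds_top_mono hx ?_
    filter_upwards [self_mem_nhdsWithin] with y hy
    have hy2 : (0 : ℝ) < 2 * y := mul_pos two_pos hy
    rw [Real.volume_closedBall, ENNReal.inv_div (Or.inr ENNReal.ofReal_ne_top)
      (Or.inr (ENNReal.ofReal_pos.2 hy2).ne'), ENNReal.ofReal_div_of_pos hy2,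
      ofReal_measureReal]
    exact ENNReal.div_le_div_right (Measure.singularPart_le μ volume _) _
  refine tendsto_atTop_mono' _ ?_ (ENNReal.tendsto_ofReal_nhds_top.1 htop)
  filter_upwards [self_mem_nhdsWithin] with y hy
  exact measureReal_closedBall_div_le_borelTransform_im μ x hy

/-- At a point without mass, `y F(x + iy)` tends to zero. -/
theorem tendsto_mul_borelTransform_zero (μ : Measure ℝ) [IsFiniteMeasure μ] {x : ℝ}
    (hx : μ {x} = 0) :
    Tendsto (fun y : ℝ => (y : ℂ) * borelTransform μ ((x : ℂ) + y * Complex.I))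
      (nhdsWithin 0 (Set.Ioi 0)) (nhds 0) := by
  simp only [borelTransform, ← integral_const_mul]
  rw [← integral_zero ℝ ℂ (μ := μ)]
  refine tendsto_integral_filter_of_dominated_convergence (fun _ => 1) ?_ ?_
    (integrable_const _) ?_
  · exact Eventually.of_forall fun y =>
      ((measurable_one_div_ofReal_sub _).const_mul _).aestronglyMeasurable
  · filter_upwards [self_mem_nhdsWithin] with y hy
    refine ae_of_all _ fun t => ?_
    have hy : 0 < y := hy
    calc ‖(y : ℂ) * (1 / ((t : ℂ) - ((x : ℂ) + y * Complex.I)))‖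
        ≤ y * (1 / y) := by
          rw [norm_mul, Complex.norm_real, Real.norm_of_nonneg hy.le]
          exact mul_le_mul_of_nonneg_left (norm_one_div_ofReal_sub_le x t hy) hy.le
      _ = 1 := mul_one_div_cancel hy.ne'
  · filter_upwards [compl_mem_ae_iff.2 hx] with t ht
    have hne : (t : ℂ) - ((x : ℂ) + (0 : ℝ) * Complex.I) ≠ 0 := by
      simpa [sub_eq_zero] using ht
    have hcont : ContinuousAt
        (fun y : ℝ => (y : ℂ) * (1 / ((t : ℂ) - ((x : ℂ) + y * Complex.I)))) 0 := by
      refine Complex.continuous_ofReal.continuousAt.mul (ContinuousAt.div continuousAt_const ?_ hne)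
      fun_prop
    simpa using hcont.tendsto.mono_left nhdsWithin_le_nhds

theorem measurableSet_setOf_measure_singleton_eq_zero (μ : Measure ℝ) [SFinite μ] :
    MeasurableSet {x : ℝ | μ {x} = 0} := by
  have h : {x : ℝ | 0 < μ {x}}.Countable :=
    Measure.countable_meas_pos_of_disjoint_iUnion (fun x => measurableSet_singleton x)
      fun _ _ hxy => disjoint_singleton.2 hxy
  have hc : {x : ℝ | μ {x} = 0} = {x : ℝ | 0 < μ {x}}ᶜ := by
    ext x
    simp
  exact hc ▸ h.measurableSet.compl

/-- The set of real points where `Im F(x+iy) → +∞` and `y·F(x+iy) → 0` as `y ↘ 0` is a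
support for the singular continuous part of `μ`. -/
theorem scPart_support (μ : Measure ℝ) [IsFiniteMeasure μ] :
    scPart μ
      ({x : ℝ |
        Tendsto (fun y : ℝ => (borelTransform μ ((x : ℂ) + y * Complex.I)).im)
          (nhdsWithin 0 (Set.Ioi 0)) atTop ∧
        Tendsto (fun y : ℝ => (y : ℂ) * borelTransform μ ((x : ℂ) + y * Complex.I))
          (nhdsWithin 0 (Set.Ioi 0)) (nhds 0)}ᶜ) = 0 := by
  refine mem_ae_iff.1 ?_
  filter_upwards [ae_restrict_of_ae (ae_singularPart_tendsto_borelTransform_im_atTop μ),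
    ae_restrict_mem (measurableSet_setOf_measure_singleton_eq_zero μ)] with x him hx
  exact ⟨him, tendsto_mul_borelTransform_zero μ hx⟩
end

section
/- Let μ be a finite Borel measure on ℝ with Borel transform F, and let a < b be real numbers. Suppose there exist an open set O ⊆ ℂ containing the interval [a, b] and a holomorphic function G : O → ℂ such that G(z) = F(z) for every z ∈ O with Im z ≠ 0. Then μ((a, b)) = 0. -/
open MeasureTheory Filter Complex Set

open scoped Topology

theorem borelTransform_conj (μ : Measure ℝ) (z : ℂ) :
    borelTransform μ ((starRingEnd ℂ) z) = (starRingEnd ℂ) (borelTransform μ z) := by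
  unfold borelTransform
  rw [← integral_conj]
  congr 1 with t
  simp

theorem integrable_one_div_sub (μ : Measure ℝ) [IsFiniteMeasure μ] {z : ℂ} (hz : z.im ≠ 0) :
    Integrable (fun t : ℝ => (1 : ℂ) / ((t : ℂ) - z)) μ := by
  refine Integrable.of_bound (Measurable.aestronglyMeasurable (by fun_prop)) |z.im|⁻¹
    (ae_of_all _ fun t => ?_)
  rw [one_div, norm_inv]
  refine inv_anti₀ (abs_pos.mpr hz) ?_
  simpa using Complex.abs_im_le_norm ((t : ℂ) - z)

theorem im_one_div_sub (t x ε : ℝ) :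
    ((1 : ℂ) / ((t : ℂ) - (x + ε * I))).im = ε / ((t - x) ^ 2 + ε ^ 2) := by
  rw [one_div, Complex.inv_im, Complex.normSq_apply]
  simp [pow_two]

theorem measureReal_closedBall_le_im_borelTransform (μ : Measure ℝ) [IsFiniteMeasure μ]
    (x : ℝ) {ε : ℝ} (hε : 0 < ε) :
    μ.real (Metric.closedBall x ε) ≤ 2 * ε * (borelTransform μ (x + ε * I)).im := by
  have hint := integrable_one_div_sub μ (z := x + ε * I) (by simpa using hε.ne')
  have him : (borelTransform μ (x + ε * I)).im = ∫ t, ε / ((t - x) ^ 2 + ε ^ 2) ∂μ := by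
    simp_rw [← im_one_div_sub]
    exact (Complex.imCLM.integral_comp_comm hint).symm
  have hint' : Integrable (fun t : ℝ => ε / ((t - x) ^ 2 + ε ^ 2)) μ := by
    simp_rw [← im_one_div_sub]
    exact hint.im
  have hmarkov := mul_meas_ge_le_integral_of_nonneg
    (ae_of_all μ fun t => show 0 ≤ ε / ((t - x) ^ 2 + ε ^ 2) by positivity) hint' (1 / (2 * ε))
  have hmono : μ.real (Metric.closedBall x ε) ≤
      μ.real {t | 1 / (2 * ε) ≤ ε / ((t - x) ^ 2 + ε ^ 2)} := by
    refine measureReal_mono fun t ht => ?_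
    rw [Metric.mem_closedBall, Real.dist_eq] at ht
    have hsq : (t - x) ^ 2 ≤ ε ^ 2 := sq_le_sq' (abs_le.mp ht).1 (abs_le.mp ht).2
    rw [mem_ofPred_eq, div_le_div_iff₀ (by positivity) (by positivity)]
    nlinarith
  rw [him]
  refine hmono.trans ?_
  rwa [← inv_mul_le_iff₀ (by positivity), ← one_div]

/-- If the Borel transform agrees off the real axis with a function continuous at a real point,
then its imaginary part vanishes vertically at that point. -/
theorem tendsto_im_borelTransform_zero (μ : Measure ℝ) {O : Set ℂ} (hO : IsOpen O) {G : ℂ → ℂ}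
    {x : ℝ} (hx : (x : ℂ) ∈ O) (hG : ContinuousAt G x)
    (hGF : ∀ z ∈ O, z.im ≠ 0 → G z = borelTransform μ z) :
    Tendsto (fun ε : ℝ => (borelTransform μ (x + ε * I)).im) (𝓝[>] 0) (𝓝 0) := by
  have key (s : ℝ) (hs : s ≠ 0) :
      Tendsto (fun ε : ℝ => (borelTransform μ (x + (s * ε : ℝ) * I)).im) (𝓝[>] 0)
        (𝓝 (G x).im) := by
    have hline : Tendsto (fun ε : ℝ => (x : ℂ) + (s * ε : ℝ) * I) (𝓝[>] 0) (𝓝 x) := by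
      refine tendsto_nhdsWithin_of_tendsto_nhds ?_
      have hcont : Continuous fun ε : ℝ => (x : ℂ) + (s * ε : ℝ) * I := by fun_prop
      simpa using hcont.tendsto 0
    refine ((Complex.continuous_im.tendsto _).comp (hG.tendsto.comp hline)).congr' ?_
    filter_upwards [hline.eventually (hO.mem_nhds hx), self_mem_nhdsWithin] with ε hε hpos
    have hne : s * ε ≠ 0 := mul_ne_zero hs (ne_of_gt hpos)
    simp only [Function.comp_apply]
    rw [hGF _ hε (by simpa using hne)]
  have hpos := key 1 one_ne_zero
  have hneg : Tendsto (fun ε : ℝ => -(borelTransform μ (x + ε * I)).im) (𝓝[>] 0)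
      (𝓝 (G x).im) := by
    refine (key (-1) (by norm_num)).congr fun ε => ?_
    rw [← Complex.conj_im, ← borelTransform_conj]
    simp
  simp only [one_mul] at hpos
  have hzero : (G x).im = 0 := by
    have := tendsto_nhds_unique hpos.neg hneg
    linarith
  rwa [hzero] at hpos

/-- A measure whose symmetric derivative with respect to Lebesgue measure vanishes at every point
of a set does not charge this set. -/
theorem measure_eq_zero_of_tendsto_closedBall_div (μ : Measure ℝ) [IsLocallyFiniteMeasure μ]
    {s : Set ℝ}
    (h : ∀ x ∈ s, Tendsto (fun ε => μ (Metric.closedBall x ε) / volume (Metric.closedBall x ε))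
      (𝓝[>] 0) (𝓝 0)) :
    μ s = 0 := by
  have hae : ∀ᵐ x ∂μ, x ∉ s := by
    filter_upwards [Besicovitch.ae_tendsto_rnDeriv volume μ, volume.rnDeriv_lt_top μ]
      with x hx hfin hxs
    have hinv := tendsto_inv_iff.mpr (h x hxs)
    rw [ENNReal.inv_zero] at hinv
    refine hfin.ne (tendsto_nhds_unique (hx.congr' ?_) hinv)
    filter_upwards [self_mem_nhdsWithin] with ε hε
    refine (ENNReal.inv_div (Or.inl measure_closedBall_lt_top.ne) (Or.inl ?_)).symm
    exact (Metric.measure_closedBall_pos volume x hε).ne'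
  simpa [ae_iff] using hae

/-- If the Borel transform of a finite Borel measure `μ` admits an analytic continuation
across the real interval `[a, b]`, then `μ((a, b)) = 0`. -/
theorem measure_zero_of_analytic_continuation (μ : Measure ℝ) [IsFiniteMeasure μ]
    (a b : ℝ) (hab : a < b) (O : Set ℂ) (hO : IsOpen O)
    (hsub : ∀ x : ℝ, x ∈ Set.Icc a b → (x : ℂ) ∈ O)
    (G : ℂ → ℂ) (hG : DifferentiableOn ℂ G O)
    (hGF : ∀ z ∈ O, z.im ≠ 0 → G z = borelTransform μ z) :
    μ (Set.Ioo a b) = 0 := by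
  refine measure_eq_zero_of_tendsto_closedBall_div μ fun x hx => ?_
  have hxO := hsub x (Ioo_subset_Icc_self hx)
  have hlim := ENNReal.tendsto_ofReal (tendsto_im_borelTransform_zero μ hO hxO
    (hG.continuousOn.continuousAt (hO.mem_nhds hxO)) hGF)
  rw [ENNReal.ofReal_zero] at hlim
  refine tendsto_of_tendsto_of_tendsto_of_le_of_le' tendsto_const_nhds hlim
    (Eventually.of_forall fun _ => zero_le) ?_
  filter_upwards [self_mem_nhdsWithin] with ε hε
  have hε' : 0 < ε := hε
  refine ENNReal.div_le_of_le_mul' ?_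
  rw [Real.volume_closedBall, ← ENNReal.ofReal_mul (by positivity), ← ofReal_measureReal]
  exact ENNReal.ofReal_le_ofReal (measureReal_closedBall_le_im_borelTransform μ x hε')
end
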